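/- arXiv:math/9911180 — 4 statements merged into one kernel-verified Lean document; each statement's English description precedes it below -/
import Mathlib

section
/- Let V be a real vector space, g : V × V → ℝ a symmetric bilinear form, and F ∈ ⋀²V a bivector. For x ∈ V define the Wick-transformed operator Mₓ on the exterior algebra ⋀V by Mₓ(u) = g(x,·)⌟u + (g(x,·)⌟F) ∧ u + x ∧ u. Then Mₓ(Mₓ(u)) = g(x,x) • u for all x ∈ V and u ∈ ⋀V; that is, the operators deformed by an arbitrary antisymmetric (bivector) part still satisfy the same Clifford square law, determined by the symmetric part g alone. -/
/-- `D` is the left contraction operator `d⌟·` on the exterior algebra `⋀V`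
associated to the linear functional `d : V → ℝ`. -/
def IsLeftContraction {V : Type*} [AddCommGroup V] [Module ℝ V]
    (d : V →ₗ[ℝ] ℝ) (D : ExteriorAlgebra ℝ V →ₗ[ℝ] ExteriorAlgebra ℝ V) : Prop :=
  D 1 = 0 ∧
  (∀ x : V, D (ExteriorAlgebra.ι ℝ x) = algebraMap ℝ (ExteriorAlgebra ℝ V) (d x)) ∧
  (∀ u v : ExteriorAlgebra ℝ V,
    D (u * v) = D u * v + CliffordAlgebra.involute u * D v)

/-- A left contraction is Mathlib's `contractLeft`, so it squares to zero. -/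
theorem IsLeftContraction.sq_zero {V : Type*} [AddCommGroup V] [Module ℝ V]
    {d : V →ₗ[ℝ] ℝ} {D : ExteriorAlgebra ℝ V →ₗ[ℝ] ExteriorAlgebra ℝ V}
    (h : IsLeftContraction d D) (u : ExteriorAlgebra ℝ V) : D (D u) = 0 := by
  obtain ⟨h1, hι, hm⟩ := h
  have key : ∀ u, D u = CliffordAlgebra.contractLeft (Q := (0 : QuadraticForm ℝ V)) d u := by
    intro u
    induction u using CliffordAlgebra.left_induction with
    | algebraMap r =>
      rw [CliffordAlgebra.contractLeft_algebraMap, Algebra.algebraMap_eq_smul_one, map_smul]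
      exact (congrArg _ h1).trans (smul_zero _)
    | add a b ha hb => rw [map_add, map_add, ha, hb]
    | ι_mul a v ha =>
      rw [CliffordAlgebra.contractLeft_ι_mul, ← ha]
      have e := hm (ExteriorAlgebra.ι ℝ v) a
      rw [hι] at e
      refine e.trans ?_
      rw [ExteriorAlgebra.ι, CliffordAlgebra.involute_ι, Algebra.smul_def, neg_mul, sub_eq_add_neg]
  rw [key, key, CliffordAlgebra.contractLeft_contractLeft]

theorem IsLeftContraction.ι_mul {V : Type*} [AddCommGroup V] [Module ℝ V]
    {d : V →ₗ[ℝ] ℝ} {D : ExteriorAlgebra ℝ V →ₗ[ℝ] ExteriorAlgebra ℝ V}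
    (h : IsLeftContraction d D) (v : V) (u : ExteriorAlgebra ℝ V) :
    D (ExteriorAlgebra.ι ℝ v * u) = d v • u - ExteriorAlgebra.ι ℝ v * D u := by
  obtain ⟨h1, hι, hm⟩ := h
  rw [hm, hι, ExteriorAlgebra.ι, CliffordAlgebra.involute_ι, Algebra.smul_def, neg_mul,
    sub_eq_add_neg]

/-- The contraction of a bivector with `d` is a vector annihilated by `d`. -/
theorem IsLeftContraction.bivector {V : Type*} [AddCommGroup V] [Module ℝ V]
    {d : V →ₗ[ℝ] ℝ} {D : ExteriorAlgebra ℝ V →ₗ[ℝ] ExteriorAlgebra ℝ V}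
    (h : IsLeftContraction d D) (F : ExteriorAlgebra ℝ V)
    (hF : F ∈ (LinearMap.range (ExteriorAlgebra.ι ℝ : V →ₗ[ℝ] ExteriorAlgebra ℝ V)) ^ 2) :
    ∃ y : V, D F = ExteriorAlgebra.ι ℝ y ∧ d y = 0 := by
  rw [pow_two] at hF
  induction hF using Submodule.mul_induction_on' with
  | mem_mul_mem m hm n hn =>
    obtain ⟨a, rfl⟩ := hm
    obtain ⟨b, rfl⟩ := hn
    refine ⟨d a • b - d b • a, ?_, ?_⟩
    · rw [h.ι_mul, h.2.1, map_sub, map_smul, map_smul, ← Algebra.commutes, ← Algebra.smul_def]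
    · simp [mul_comm]
  | add a _ b _ ha hb =>
    obtain ⟨y, hy, hy'⟩ := ha
    obtain ⟨z, hz, hz'⟩ := hb
    exact ⟨y + z, by rw [map_add, map_add, hy, hz], by rw [map_add, hy', hz', add_zero]⟩

/-- For a symmetric bilinear form `g` on a real vector space `V` and a bivector
`F ∈ ⋀²V`, the Wick-transformed operators
`Mₓ(u) = g(x,·)⌟u + (g(x,·)⌟F) ∧ u + x ∧ u` on `⋀V` still satisfy the Clifford
square law `Mₓ(Mₓ(u)) = g(x,x) • u`. -/
theorem wick_transformed_square_law {V : Type*} [AddCommGroup V] [Module ℝ V]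
    (g : V →ₗ[ℝ] V →ₗ[ℝ] ℝ)
    (hg : ∀ x y : V, g x y = g y x)
    (F : ExteriorAlgebra ℝ V)
    (hF : F ∈ (LinearMap.range (ExteriorAlgebra.ι ℝ : V →ₗ[ℝ] ExteriorAlgebra ℝ V)) ^ 2)
    (D : V → (ExteriorAlgebra ℝ V →ₗ[ℝ] ExteriorAlgebra ℝ V))
    (hD : ∀ x : V, IsLeftContraction (g x) (D x)) :
    ∀ (x : V) (u : ExteriorAlgebra ℝ V),
      (fun w => D x w + D x F * w + ExteriorAlgebra.ι ℝ x * w)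
        ((fun w => D x w + D x F * w + ExteriorAlgebra.ι ℝ x * w) u) = g x x • u := by
  intro x u
  obtain ⟨y, hy, hy'⟩ := (hD x).bivector F hF
  have hM : ∀ w, D x w + D x F * w + ExteriorAlgebra.ι ℝ x * w
      = D x w + ExteriorAlgebra.ι ℝ (y + x) * w := by
    intro w
    rw [hy, map_add, add_mul, add_assoc]
  simp only [hM]
  rw [map_add, (hD x).sq_zero, (hD x).ι_mul, mul_add, ← mul_assoc, ExteriorAlgebra.ι_sq_zero,
    zero_mul, map_add, hy', zero_add, zero_add, add_zero, sub_add_cancel]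
end

section
/- Let V be a finite-dimensional real vector space, g : V × V → ℝ a symmetric bilinear form, and F ∈ ⋀²V a bivector. For x ∈ V let Lₓ(u) = g(x,·)⌟u + x ∧ u be the undeformed Clifford operator on ⋀V. Then conjugation of Lₓ by the exterior exponential of F produces exactly the Wick-transformed operator: for all x ∈ V and u ∈ ⋀V, e∧^{−F} ∧ Lₓ( e∧^{F} ∧ u ) = g(x,·)⌟u + (g(x,·)⌟F) ∧ u + x ∧ u. -/
/-- The exterior exponential `e∧^F = Σ_{k≥0} (1/k!) F^∧k`, a finite sum. -/
noncomputable def expWedge {V : Type*} [AddCommGroup V] [Module ℝ V]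
    [FiniteDimensional ℝ V] (F : ExteriorAlgebra ℝ V) : ExteriorAlgebra ℝ V :=
  ∑ k ∈ Finset.range (Module.finrank ℝ V + 1), ((k.factorial : ℝ))⁻¹ • F ^ k

theorem wc_induct {V : Type*} [AddCommGroup V] [Module ℝ V]
    {C : ExteriorAlgebra ℝ V → Prop}
    (h1 : ∀ x y, C (ExteriorAlgebra.ι ℝ x * ExteriorAlgebra.ι ℝ y))
    (h2 : ∀ a b, C a → C b → C (a + b))
    (F : ExteriorAlgebra ℝ V)
    (hF : F ∈ (LinearMap.range (ExteriorAlgebra.ι ℝ : V →ₗ[ℝ] ExteriorAlgebra ℝ V)) ^ 2) :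
    C F := by
  rw [pow_two] at hF
  induction hF using Submodule.mul_induction_on' with
  | mem_mul_mem m hm n hn =>
    obtain ⟨x, rfl⟩ := hm
    obtain ⟨y, rfl⟩ := hn
    exact h1 x y
  | add a _ b _ ha hb => exact h2 a b ha hb

theorem wc_commute {V : Type*} [AddCommGroup V] [Module ℝ V]
    (F : ExteriorAlgebra ℝ V)
    (hF : F ∈ (LinearMap.range (ExteriorAlgebra.ι ℝ : V →ₗ[ℝ] ExteriorAlgebra ℝ V)) ^ 2)
    (u : ExteriorAlgebra ℝ V) : Commute F u := by
  refine wc_induct (C := fun F => Commute F u) ?_ (fun a b ha hb => ha.add_left hb) F hF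
  intro x y
  induction u using ExteriorAlgebra.induction with
  | algebraMap r => exact (Algebra.commutes r _).symm
  | ι z =>
    have e (a b : V) : ExteriorAlgebra.ι ℝ a * ExteriorAlgebra.ι ℝ b
        = - (ExteriorAlgebra.ι ℝ b * ExteriorAlgebra.ι ℝ a) :=
      eq_neg_of_add_eq_zero_left (ExteriorAlgebra.ι_add_mul_swap a b)
    change _ * _ = _ * _
    rw [mul_assoc, e y z, mul_neg, ← mul_assoc, e x z, neg_mul, neg_neg, mul_assoc]
  | mul a b ha hb => exact ha.mul_right hb
  | add a b ha hb => exact ha.add_right hb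

theorem wc_involute {V : Type*} [AddCommGroup V] [Module ℝ V]
    (F : ExteriorAlgebra ℝ V)
    (hF : F ∈ (LinearMap.range (ExteriorAlgebra.ι ℝ : V →ₗ[ℝ] ExteriorAlgebra ℝ V)) ^ 2) :
    CliffordAlgebra.involute F = F := by
  refine wc_induct (C := fun F => CliffordAlgebra.involute F = F) ?_ ?_ F hF
  · intro x y
    have e (a : V) : CliffordAlgebra.involute (ExteriorAlgebra.ι ℝ a)
        = - ExteriorAlgebra.ι ℝ a := CliffordAlgebra.involute_ι a
    rw [map_mul, e, e, neg_mul_neg]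
  · intro a b ha hb
    rw [map_add, ha, hb]

theorem wc_pow {V : Type*} [AddCommGroup V] [Module ℝ V] [FiniteDimensional ℝ V]
    (F : ExteriorAlgebra ℝ V)
    (hF : F ∈ (LinearMap.range (ExteriorAlgebra.ι ℝ : V →ₗ[ℝ] ExteriorAlgebra ℝ V)) ^ 2) :
    F ^ (Module.finrank ℝ V + 1) = 0 := by
  have h := Submodule.pow_mem_pow _ hF (Module.finrank ℝ V + 1)
  rw [← pow_mul] at h
  have h0 : Module.finrank ℝ (⋀[ℝ]^(2 * (Module.finrank ℝ V + 1)) V) = 0 := by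
    rw [exteriorPower.finrank_eq]
    exact Nat.choose_eq_zero_of_lt (by lia)
  have h1 := Submodule.finrank_eq_zero.mp h0
  have h2 : F ^ (Module.finrank ℝ V + 1) ∈ (⋀[ℝ]^(2 * (Module.finrank ℝ V + 1)) V) := h
  rw [h1] at h2
  simpa using h2

theorem wc_exp {V : Type*} [AddCommGroup V] [Module ℝ V] [FiniteDimensional ℝ V]
    (F : ExteriorAlgebra ℝ V) (hF : F ^ (Module.finrank ℝ V + 1) = 0) :
    expWedge (-F) * expWedge F = 1 := by
  letI : Algebra ℚ (ExteriorAlgebra ℝ V) := Algebra.compHom _ (algebraMap ℚ ℝ)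
  have key (G : ExteriorAlgebra ℝ V) (hG : G ^ (Module.finrank ℝ V + 1) = 0) :
      expWedge G = IsNilpotent.exp G := by
    rw [IsNilpotent.exp_eq_sum hG, expWedge]
    refine Finset.sum_congr rfl fun k _ => ?_
    change _ = (algebraMap ℚ ℝ ((k.factorial : ℚ)⁻¹)) • G ^ k
    simp
  rw [key F hF, key (-F) (by rw [neg_pow, hF, mul_zero])]
  exact IsNilpotent.exp_neg_mul_exp_self ⟨_, hF⟩

theorem wc_deriv {V : Type*} [AddCommGroup V] [Module ℝ V] [FiniteDimensional ℝ V]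
    (F : ExteriorAlgebra ℝ V)
    (hF : F ∈ (LinearMap.range (ExteriorAlgebra.ι ℝ : V →ₗ[ℝ] ExteriorAlgebra ℝ V)) ^ 2)
    (d : V →ₗ[ℝ] ℝ) (D : ExteriorAlgebra ℝ V →ₗ[ℝ] ExteriorAlgebra ℝ V)
    (hD : IsLeftContraction d D) : D (expWedge F) = expWedge F * D F := by
  obtain ⟨h1, -, h3⟩ := hD
  have hp (k : ℕ) : D (F ^ (k + 1)) = ((k : ℝ) + 1) • (F ^ k * D F) := by
    induction k with
    | zero => simp
    | succ k ih =>
      rw [pow_succ' F (k + 1), h3, wc_involute F hF, ih, mul_smul_comm, ← mul_assoc, ← pow_succ',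
        ← ((wc_commute F hF (D F)).pow_left (k + 1)).eq]
      push_cast
      module
  have h0 := hp (Module.finrank ℝ V)
  rw [wc_pow F hF, map_zero, eq_comm, smul_eq_zero] at h0
  have h0 := h0.resolve_left (by positivity)
  rw [expWedge, map_sum, Finset.sum_mul, Finset.sum_range_succ', Finset.sum_range_succ]
  simp only [smul_mul_assoc, h0, smul_zero, map_smul, pow_zero, h1, add_zero]
  refine Finset.sum_congr rfl fun k _ => ?_
  rw [hp, smul_smul, Nat.factorial_succ]
  congr 1
  push_cast
  have : (k : ℝ) + 1 ≠ 0 := by positivity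
  field_simp

/-- Conjugating the undeformed Clifford operator `Lₓ(u) = g(x,·)⌟u + x ∧ u` by
the exterior exponential of a bivector `F` produces the Wick-transformed
operator: `e∧^{−F} ∧ Lₓ(e∧^{F} ∧ u) = g(x,·)⌟u + (g(x,·)⌟F) ∧ u + x ∧ u`. -/
theorem wick_conjugation {V : Type*} [AddCommGroup V] [Module ℝ V]
    [FiniteDimensional ℝ V]
    (g : V →ₗ[ℝ] V →ₗ[ℝ] ℝ)
    (hg : ∀ x y : V, g x y = g y x)
    (F : ExteriorAlgebra ℝ V)
    (hF : F ∈ (LinearMap.range (ExteriorAlgebra.ι ℝ : V →ₗ[ℝ] ExteriorAlgebra ℝ V)) ^ 2)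
    (D : V → (ExteriorAlgebra ℝ V →ₗ[ℝ] ExteriorAlgebra ℝ V))
    (hD : ∀ x : V, IsLeftContraction (g x) (D x)) :
    ∀ (x : V) (u : ExteriorAlgebra ℝ V),
      expWedge (-F) *
          (D x (expWedge F * u) + ExteriorAlgebra.ι ℝ x * (expWedge F * u))
        = D x u + D x F * u + ExteriorAlgebra.ι ℝ x * u := by
  intro x u
  have hc (G) (u : ExteriorAlgebra ℝ V) (hG : ∀ k : ℕ, Commute (G ^ k) u) :
      Commute (expWedge G) u :=
    Commute.sum_left _ _ _ fun k _ => (hG k).smul_left _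
  have hcF (u) : Commute (expWedge F) u := hc F u fun k => (wc_commute F hF u).pow_left k
  have hi : CliffordAlgebra.involute (expWedge F) = expWedge F := by
    simp only [expWedge, map_sum, map_smul, map_pow, wc_involute F hF]
  have he := wc_exp F (wc_pow F hF)
  rw [(hD x).2.2, hi, wc_deriv F hF _ _ (hD x), ← mul_assoc (ExteriorAlgebra.ι ℝ x),
    ← (hcF (ExteriorAlgebra.ι ℝ x)).eq, mul_assoc, mul_assoc, ← mul_add, ← mul_add, ← mul_assoc,
    he, one_mul, add_comm (D x F * u)]
end

section
/- Let p, q ≥ 1 be integers and let Q_{p,q} denote the standard quadratic form of signature (p,q) on ℝ^{p+q}. Then there is an isomorphism of ℝ-algebras Cl_{p,q} ≅ Cl_{p−1,q−1} ⊗_ℝ Cl_{1,1} between the Clifford algebra of Q_{p,q} and the tensor product of the Clifford algebras of Q_{p−1,q−1} and Q_{1,1}. -/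
open scoped TensorProduct

/-- The standard quadratic form `Q_{p,q}(x) = x₁² + ⋯ + x_p² − x_{p+1}² − ⋯ − x_{p+q}²`
of signature `(p,q)` on `ℝ^{p+q}`. -/
noncomputable def standardQF (p q : ℕ) : QuadraticForm ℝ (Fin (p + q) → ℝ) :=
  QuadraticMap.weightedSumSquares ℝ (fun i : Fin (p + q) => if (i : ℕ) < p then (1 : ℝ) else -1)

section Helpers

variable {M₁ M₂ : Type*} [AddCommGroup M₁] [AddCommGroup M₂] [Module ℝ M₁] [Module ℝ M₂]

open CliffordAlgebra

/-- If `ω = ab` squares to one and anticommutes with the vectors of `Q₂`, then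
`Cl(Q₁ ⊕ Q₂)` is the ungraded tensor product of `Cl(Q₁)` and `Cl(Q₂)`. -/
theorem clifford_prod_equiv (Q₁ : QuadraticForm ℝ M₁) (Q₂ : QuadraticForm ℝ M₂) (a b : M₂)
    (hsq : (ι Q₂ a * ι Q₂ b) * (ι Q₂ a * ι Q₂ b) = 1)
    (hanti : ∀ m, (ι Q₂ a * ι Q₂ b) * ι Q₂ m = - (ι Q₂ m * (ι Q₂ a * ι Q₂ b))) :
    Nonempty (CliffordAlgebra (Q₁.prod Q₂) ≃ₐ[ℝ]
      (CliffordAlgebra Q₁ ⊗[ℝ] CliffordAlgebra Q₂)) := by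
  set ω := ι Q₂ a * ι Q₂ b with hω
  let f : M₁ × M₂ →ₗ[ℝ] CliffordAlgebra Q₁ ⊗[ℝ] CliffordAlgebra Q₂ :=
    (((TensorProduct.mk ℝ (CliffordAlgebra Q₁) (CliffordAlgebra Q₂)).flip ω).comp (ι Q₁)).coprod
      ((TensorProduct.mk ℝ (CliffordAlgebra Q₁) (CliffordAlgebra Q₂) 1).comp (ι Q₂))
  have f_apply : ∀ m, f m = ι Q₁ m.1 ⊗ₜ ω + 1 ⊗ₜ ι Q₂ m.2 := fun m => rfl
  have hf : ∀ m, f m * f m = algebraMap ℝ _ ((Q₁.prod Q₂) m) := by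
    intro m
    rw [f_apply]
    simp only [mul_add, add_mul, Algebra.TensorProduct.tmul_mul_tmul, hsq, mul_one, one_mul,
      hanti, ι_sq_scalar, QuadraticMap.prod_apply, map_add, TensorProduct.tmul_neg]
    rw [← Algebra.TensorProduct.algebraMap_apply, 
      show (1 : CliffordAlgebra Q₁) ⊗ₜ[ℝ] (algebraMap ℝ (CliffordAlgebra Q₂) (Q₂ m.2)) =
        algebraMap ℝ _ (Q₂ m.2) from (Algebra.TensorProduct.algebraMap_apply' _).symm]
    abel
  let F : CliffordAlgebra (Q₁.prod Q₂) →ₐ[ℝ] CliffordAlgebra Q₁ ⊗[ℝ] CliffordAlgebra Q₂ :=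
    lift (Q₁.prod Q₂) ⟨f, hf⟩
  have F_ι : ∀ m, F (ι _ m) = f m := fun m => lift_ι_apply _ _ _
  let R : CliffordAlgebra Q₂ →ₐ[ℝ] CliffordAlgebra (Q₁.prod Q₂) :=
    CliffordAlgebra.map (QuadraticMap.Isometry.inr Q₁ Q₂)
  have R_ι : ∀ m, R (ι _ m) = ι _ (0, m) := fun m => map_apply_ι _ _
  have anti : ∀ m₁ m₂, ι (Q₁.prod Q₂) (m₁, 0) * ι (Q₁.prod Q₂) (0, m₂) =
      - (ι (Q₁.prod Q₂) (0, m₂) * ι (Q₁.prod Q₂) (m₁, 0)) := by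
    intro m₁ m₂
    rw [eq_neg_iff_add_eq_zero, ι_mul_ι_add_swap]
    simp [QuadraticMap.polar]
  have Rω : R ω = ι _ (0, a) * ι _ (0, b) := by rw [hω, map_mul, R_ι, R_ι]
  have Rsq : R ω * R ω = 1 := by rw [← map_mul, hsq, map_one]
  have comm : ∀ m₁, ι (Q₁.prod Q₂) (m₁, 0) * R ω = R ω * ι (Q₁.prod Q₂) (m₁, 0) := by
    intro m₁
    rw [Rω, ← mul_assoc, anti, neg_mul, mul_assoc, anti, mul_neg, neg_neg, mul_assoc]
  let g : M₁ →ₗ[ℝ] CliffordAlgebra (Q₁.prod Q₂) :=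
    (LinearMap.mulRight ℝ (R ω)).comp ((ι (Q₁.prod Q₂)).comp (LinearMap.inl ℝ M₁ M₂))
  have g_apply : ∀ m, g m = ι _ (m, 0) * R ω := fun m => rfl
  have hg : ∀ m, g m * g m = algebraMap ℝ _ (Q₁ m) := by
    intro m
    rw [g_apply, mul_assoc, ← mul_assoc (R ω), ← comm, mul_assoc, Rsq, mul_one, ι_sq_scalar]
    simp
  let L : CliffordAlgebra Q₁ →ₐ[ℝ] CliffordAlgebra (Q₁.prod Q₂) := lift Q₁ ⟨g, hg⟩
  have L_ι : ∀ m, L (ι _ m) = g m := fun m => lift_ι_apply _ _ _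
  have c0 : ∀ m₁ m₂, Commute (L (ι _ m₁)) (R (ι _ m₂)) := by
    intro m₁ m₂
    rw [L_ι, g_apply, Commute, SemiconjBy, mul_assoc, ← map_mul, hanti, map_neg, map_mul,
      R_ι, mul_neg, ← mul_assoc, anti, neg_mul, neg_neg, mul_assoc]
  have c1 : ∀ m₁ y, Commute (L (ι _ m₁)) (R y) := by
    intro m₁ y
    induction y using CliffordAlgebra.induction with
    | algebraMap r => rw [AlgHom.commutes]; exact (Algebra.commutes r _).symm
    | ι x => exact c0 _ _
    | mul x y hx hy => rw [map_mul]; exact hx.mul_right hy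
    | add x y hx hy => rw [map_add]; exact hx.add_right hy
  have c2 : ∀ x y, Commute (L x) (R y) := by
    intro x y
    induction x using CliffordAlgebra.induction with
    | algebraMap r => rw [AlgHom.commutes]; exact Algebra.commutes r _
    | ι x => exact c1 _ _
    | mul x y hx hy => rw [map_mul]; exact hx.mul_left hy
    | add x y hx hy => rw [map_add]; exact hx.add_left hy
  let G : CliffordAlgebra Q₁ ⊗[ℝ] CliffordAlgebra Q₂ →ₐ[ℝ] CliffordAlgebra (Q₁.prod Q₂) :=
    Algebra.TensorProduct.lift L R c2
  have G_tmul : ∀ x y, G (x ⊗ₜ y) = L x * R y := fun x y =>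
    Algebra.TensorProduct.lift_tmul _ _ _ _ _
  have FR : ∀ y, F (R y) = 1 ⊗ₜ y := by
    intro y
    have : F.comp R = Algebra.TensorProduct.includeRight := by
      apply CliffordAlgebra.hom_ext
      ext m
      simp [R_ι, F_ι, f_apply]
    exact DFunLike.congr_fun this y
  have FL : ∀ x, F (L x) = x ⊗ₜ 1 := by
    intro x
    have : F.comp L = Algebra.TensorProduct.includeLeft := by
      apply CliffordAlgebra.hom_ext
      ext m
      simp [L_ι, g_apply, F_ι, f_apply, FR, hsq]
    exact DFunLike.congr_fun this x
  refine ⟨AlgEquiv.ofAlgHom F G ?_ ?_⟩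
  · apply Algebra.TensorProduct.ext'
    intro x y
    simp [G_tmul, FL, FR]
  · apply CliffordAlgebra.hom_ext
    apply LinearMap.ext
    intro m
    change G (F (ι _ m)) = ι _ m
    rw [F_ι, f_apply, map_add, G_tmul, G_tmul, L_ι, g_apply, mul_assoc, Rsq, mul_one, map_one,
      one_mul, R_ι, ← map_add]
    simp

end Helpers

theorem standardQF_apply_sum (p q : ℕ) (x : Fin (p + q) → ℝ) :
    standardQF p q x = (∑ i : Fin p, x (Fin.castAdd q i) * x (Fin.castAdd q i)) -
      ∑ i : Fin q, x (Fin.natAdd p i) * x (Fin.natAdd p i) := by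
  simp [standardQF, QuadraticMap.weightedSumSquares_apply, Fin.sum_univ_add, sub_eq_add_neg]

/-- Splitting of the index set. -/
def splitIdx (p q : ℕ) : Fin (p + q) ⊕ Fin (1 + 1) ≃ Fin (p + 1 + (q + 1)) :=
  ((finSumFinEquiv.symm.sumCongr finSumFinEquiv.symm).trans (Equiv.sumSumSumComm _ _ _ _)).trans
    ((finSumFinEquiv.sumCongr finSumFinEquiv).trans finSumFinEquiv)

theorem standardQF_equivalent (p q : ℕ) :
    Nonempty ((standardQF (p + 1) (q + 1)).IsometryEquiv
      ((standardQF p q).prod (standardQF 1 1))) := by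
  let e : (Fin (p + 1 + (q + 1)) → ℝ) ≃ₗ[ℝ] (Fin (p + q) → ℝ) × (Fin (1 + 1) → ℝ) :=
    (LinearEquiv.funCongrLeft ℝ ℝ (splitIdx p q)).trans
      (LinearEquiv.sumArrowLequivProdArrow _ _ ℝ ℝ)
  have e1 : ∀ x i, (e x).1 i = x (splitIdx p q (Sum.inl i)) := fun x i => rfl
  have e2 : ∀ x i, (e x).2 i = x (splitIdx p q (Sum.inr i)) := fun x i => rfl
  refine ⟨⟨e, fun x => ?_⟩⟩
  change ((standardQF p q).prod (standardQF 1 1)) (e x) = _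
  rw [QuadraticMap.prod_apply, standardQF_apply_sum, standardQF_apply_sum, standardQF_apply_sum]
  simp only [e1, e2, splitIdx]
  rw [Fin.sum_univ_add (a := p) (b := 1), Fin.sum_univ_add (a := q) (b := 1)]
  simp only [Equiv.trans_apply, Equiv.sumCongr_apply, Sum.map_inl, Sum.map_inr,
    finSumFinEquiv_symm_apply_castAdd, finSumFinEquiv_symm_apply_natAdd,
    Equiv.sumSumSumComm_apply, finSumFinEquiv_apply_left, finSumFinEquiv_apply_right]
  simp
  ring

open CliffordAlgebra in
theorem clifford_periodicity_aux (p q : ℕ) :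
    Nonempty (CliffordAlgebra (standardQF (p + 1) (q + 1)) ≃ₐ[ℝ]
      (CliffordAlgebra (standardQF p q) ⊗[ℝ] CliffordAlgebra (standardQF 1 1))) := by
  obtain ⟨E⟩ := standardQF_equivalent p q
  set a : Fin (1 + 1) → ℝ := ![1, 0] with ha
  set b : Fin (1 + 1) → ℝ := ![0, 1] with hb
  have Qval : ∀ x, standardQF 1 1 x = x 0 * x 0 - x 1 * x 1 := by
    intro x
    rw [standardQF_apply_sum]
    simp
  have haa : ι (standardQF 1 1) a * ι (standardQF 1 1) a = 1 := by
    rw [ι_sq_scalar, Qval]; simp [ha]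
  have hbb : ι (standardQF 1 1) b * ι (standardQF 1 1) b = -1 := by
    rw [ι_sq_scalar, Qval]; simp [hb]
  have hba : ι (standardQF 1 1) b * ι (standardQF 1 1) a =
      - (ι (standardQF 1 1) a * ι (standardQF 1 1) b) := by
    rw [eq_neg_iff_add_eq_zero, ι_mul_ι_add_swap, QuadraticMap.polar, Qval, Qval, Qval]
    simp [ha, hb]
  have hdec : ∀ m : Fin (1 + 1) → ℝ, m = m 0 • a + m 1 • b := by
    intro m
    ext i
    fin_cases i <;> simp [ha, hb]
  obtain ⟨Φ⟩ := clifford_prod_equiv (standardQF p q) (standardQF 1 1) a b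
    (by
      rw [mul_assoc, ← mul_assoc (ι _ b), hba, neg_mul, mul_assoc, hbb, mul_neg, mul_neg,
        mul_neg, mul_one, neg_neg, haa])
    (by
      intro m
      rw [hdec m]
      generalize m 0 = s
      generalize m 1 = t
      simp only [map_add, map_smul, mul_add, add_mul, mul_smul_comm, smul_mul_assoc]
      rw [neg_add, ← smul_neg, ← smul_neg]
      congr 2
      · rw [mul_assoc, hba, mul_neg]
      · rw [← mul_assoc (ι _ b), hba, neg_mul, neg_neg])
  exact ⟨(CliffordAlgebra.equivOfIsometry E).trans Φ⟩

/-- Periodicity theorem: for `p, q ≥ 1` there is an isomorphism of ℝ-algebras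
`Cl_{p,q} ≅ Cl_{p−1,q−1} ⊗_ℝ Cl_{1,1}`, where the tensor product carries the
ordinary (ungraded) algebra structure. -/
theorem clifford_periodicity (p q : ℕ) (hp : 1 ≤ p) (hq : 1 ≤ q) :
    Nonempty (CliffordAlgebra (standardQF p q) ≃ₐ[ℝ]
      (CliffordAlgebra (standardQF (p - 1) (q - 1)) ⊗[ℝ] CliffordAlgebra (standardQF 1 1))) := by
  obtain ⟨p, rfl⟩ := Nat.exists_eq_add_of_le' hp
  obtain ⟨q, rfl⟩ := Nat.exists_eq_add_of_le' hq
  exact clifford_periodicity_aux p q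
end

section
/- Let a, λ ∈ ℝ satisfy 4 − λ²a² − 4λ² ≥ 0, and let Cl be the Clifford algebra of the quadratic form Q(x) = x₁² + a·x₁x₂ − x₂² on ℝ² (whose polar form has Gram matrix [[1, a/2],[a/2, −1]]), with generators e₁, e₂. Then the element f := ¼(2 + λa)·1 + ¼√(4 − λ²a² − 4λ²)·e₁ + ½λ·(e₁e₂ − a·1) is an idempotent, f² = f; equivalently, the element X := 2f − 1 = −½λa·1 + ½√(4 − λ²a² − 4λ²)·e₁ + λ·e₁e₂ satisfies X² = 1. (Here e₁e₂ − a·1 is the wedge bivector e₁∧e₂ of the quantum Clifford algebra Cl(B) with bilinear form B = [[1, a],[0, −1]].) -/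
/-- The quadratic form `Q(x) = x₁² + a·x₁x₂ − x₂²` on `ℝ²`, obtained from the
bilinear form with matrix `B = [[1, a],[0, −1]]` (whose symmetric part has Gram
matrix `[[1, a/2],[a/2, −1]]`). -/
noncomputable def qfa (a : ℝ) : QuadraticForm ℝ (Fin 2 → ℝ) :=
  LinearMap.BilinMap.toQuadraticMap (Matrix.toLinearMap₂' ℝ !![1, a; 0, -1])

/-- The generators `e₁ = e 0`, `e₂ = e 1` of the Clifford algebra of `qfa a`,
satisfying `e₁² = 1`, `e₂² = −1`, `e₁e₂ + e₂e₁ = a·1`. -/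
noncomputable def e (a : ℝ) (i : Fin 2) : CliffordAlgebra (qfa a) :=
  CliffordAlgebra.ι (qfa a) (Pi.single i 1)

theorem qfa_apply (a : ℝ) (x : Fin 2 → ℝ) :
    qfa a x = x 0 * x 0 + a * (x 0 * x 1) - x 1 * x 1 := by
  simp [qfa, Matrix.toLinearMap₂'_apply, Fin.sum_univ_two]
  ring

theorem e_sq_zero (a : ℝ) : e a 0 * e a 0 = 1 := by
  unfold e
  rw [CliffordAlgebra.ι_sq_scalar]
  simp [qfa_apply]

theorem e_sq_one (a : ℝ) : e a 1 * e a 1 = -1 := by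
  unfold e
  rw [CliffordAlgebra.ι_sq_scalar]
  simp [qfa_apply]

theorem e_anticomm (a : ℝ) : e a 1 * e a 0 = a • (1 : CliffordAlgebra (qfa a)) - e a 0 * e a 1 := by
  rw [eq_sub_iff_add_eq]
  unfold e
  rw [CliffordAlgebra.ι_mul_ι_add_swap, Algebra.algebraMap_eq_smul_one]
  congr 1
  simp [QuadraticMap.polar, qfa_apply]

theorem X_sq {A : Type*} [Ring A] [Algebra ℝ A] (a l s : ℝ) (u v : A)
    (hs : s * s = 4 - l ^ 2 * a ^ 2 - 4 * l ^ 2)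
    (hu : u * u = 1) (hv : v * v = -1) (hvu : v * u = a • (1 : A) - u * v) :
    ((-(1 / 2) * l * a) • (1 : A) + (1 / 2 * s) • u + l • (u * v)) ^ 2 = 1 := by
  have h1 : u * (u * v) = v := by rw [← mul_assoc, hu, one_mul]
  have h2 : (u * v) * u = a • u - v := by
    rw [mul_assoc, hvu, mul_sub, h1, mul_smul_comm, mul_one]
  have h3 : (u * v) * (u * v) = a • (u * v) + 1 := by
    rw [← mul_assoc, h2, sub_mul, hv, smul_mul_assoc, sub_neg_eq_add]
  have key : ((-(1 / 2) * l * a) • (1 : A) + (1 / 2 * s) • u + l • (u * v)) ^ 2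
      = (1 / 4 * (s * s) + 1 / 4 * l ^ 2 * a ^ 2 + l ^ 2) • (1 : A) := by
    rw [pow_two]
    simp only [add_mul, mul_add, smul_mul_assoc, mul_smul_comm, one_mul, mul_one, h1, h2, h3, hu]
    module
  rw [key, hs]
  module

/-- For `a, λ ∈ ℝ` with `4 − λ²a² − 4λ² ≥ 0`, the element
`f = ¼(2 + λa)·1 + ¼√(4 − λ²a² − 4λ²)·e₁ + ½λ·(e₁e₂ − a·1)` of the Clifford
algebra of `Q(x) = x₁² + a·x₁x₂ − x₂²` is an idempotent; equivalently,
`X = 2f − 1 = −½λa·1 + ½√(4 − λ²a² − 4λ²)·e₁ + λ·e₁e₂` satisfies `X² = 1`. -/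
theorem quantum_clifford_idempotent (a l : ℝ)
    (h : 0 ≤ 4 - l ^ 2 * a ^ 2 - 4 * l ^ 2) :
    ((1 / 4 * (2 + l * a)) • (1 : CliffordAlgebra (qfa a))
        + (1 / 4 * Real.sqrt (4 - l ^ 2 * a ^ 2 - 4 * l ^ 2)) • e a 0
        + (1 / 2 * l) • (e a 0 * e a 1 - a • (1 : CliffordAlgebra (qfa a))))
      * ((1 / 4 * (2 + l * a)) • (1 : CliffordAlgebra (qfa a))
        + (1 / 4 * Real.sqrt (4 - l ^ 2 * a ^ 2 - 4 * l ^ 2)) • e a 0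
        + (1 / 2 * l) • (e a 0 * e a 1 - a • (1 : CliffordAlgebra (qfa a))))
      = (1 / 4 * (2 + l * a)) • (1 : CliffordAlgebra (qfa a))
        + (1 / 4 * Real.sqrt (4 - l ^ 2 * a ^ 2 - 4 * l ^ 2)) • e a 0
        + (1 / 2 * l) • (e a 0 * e a 1 - a • (1 : CliffordAlgebra (qfa a))) ∧
    ((-(1 / 2) * l * a) • (1 : CliffordAlgebra (qfa a))
        + (1 / 2 * Real.sqrt (4 - l ^ 2 * a ^ 2 - 4 * l ^ 2)) • e a 0
        + l • (e a 0 * e a 1)) ^ 2 = 1 := by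
  have hX := X_sq a l _ (e a 0) (e a 1) (Real.mul_self_sqrt h)
    (e_sq_zero a) (e_sq_one a) (e_anticomm a)
  refine ⟨?_, hX⟩
  generalize Real.sqrt (4 - l ^ 2 * a ^ 2 - 4 * l ^ 2) = s at hX ⊢
  generalize hXd : (-(1 / 2) * l * a) • (1 : CliffordAlgebra (qfa a))
        + (1 / 2 * s) • e a 0 + l • (e a 0 * e a 1) = X at hX
  have hf : (1 / 4 * (2 + l * a)) • (1 : CliffordAlgebra (qfa a))
        + (1 / 4 * s) • e a 0
        + (1 / 2 * l) • (e a 0 * e a 1 - a • (1 : CliffordAlgebra (qfa a)))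
      = (1 / 2 : ℝ) • (1 + X) := by
    rw [← hXd]
    module
  rw [hf]
  rw [pow_two] at hX
  simp only [add_mul, mul_add, smul_mul_assoc, mul_smul_comm, one_mul, mul_one, hX]
  module
end
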